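/- arXiv:1501.05547 — 2 statements merged into one kernel-verified Lean document; each statement's English description precedes it below -/
import Mathlib

section
/- The TAP instance J₂ with subjects {F,I,M}, applicants a₁ (type FM, preference list s₂, s₁), a₂ (type IM, preference list s₁, s₂), a₃ (type FI, preference list s₁), and schools s₁ (capacities c_F=1, c_I=1, c_M=2, preference list a₁, a₃, a₂) and s₂ (capacities c_F=1, c_I=1, c_M=1, preference list a₂, a₁) admits no stable matching. -/
structure TAP (A : Type*) (S : Type*) (P : Type*) where
  ptype : A → Finset P
  prefA : A → List S
  cap : S → P → ℕ
  prefS : S → List A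

namespace TAP

variable {A S P : Type*} [DecidableEq A] [DecidableEq S] [DecidableEq P] (J : TAP A S P)

def WellFormed : Prop :=
  (∀ a, (J.ptype a).card = 2) ∧ (∀ a, (J.prefA a).Nodup) ∧
  (∀ s, (J.prefS s).Nodup) ∧ (∀ a s, a ∈ J.prefS s ↔ s ∈ J.prefA a)

def IsAssignment (M : Finset (A × S)) : Prop :=
  (∀ x ∈ M, x.2 ∈ J.prefA x.1) ∧
  ∀ a s s', (a, s) ∈ M → (a, s') ∈ M → s = s'

def Mp (M : Finset (A × S)) (s : S) (p : P) : Finset A :=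
  (M.filter (fun x => x.2 = s ∧ p ∈ J.ptype x.1)).image Prod.fst

def Mpr (M : Finset (A × S)) (s : S) (p r : P) : Finset A :=
  (M.filter (fun x => x.2 = s ∧ J.ptype x.1 = {p, r})).image Prod.fst

def IsMatching (M : Finset (A × S)) : Prop :=
  J.IsAssignment M ∧ ∀ s p, (J.Mp M s p).card ≤ J.cap s p

def Undersub (M : Finset (A × S)) (s : S) (p : P) : Prop :=
  (J.Mp M s p).card < J.cap s p

def PrefersA (a : A) (s s' : S) : Prop :=
  s ∈ J.prefA a ∧ s' ∈ J.prefA a ∧ (J.prefA a).idxOf s < (J.prefA a).idxOf s'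

def PrefersS (s : S) (a a' : A) : Prop :=
  a ∈ J.prefS s ∧ a' ∈ J.prefS s ∧ (J.prefS s).idxOf a < (J.prefS s).idxOf a'

def Unassigned (M : Finset (A × S)) (a : A) : Prop := ∀ s, (a, s) ∉ M

def Blocks (M : Finset (A × S)) (a : A) (s : S) : Prop :=
  s ∈ J.prefA a ∧
  (Unassigned M a ∨ ∃ s', (a, s') ∈ M ∧ J.PrefersA a s s') ∧
  ∃ p₁ p₂, p₁ ≠ p₂ ∧ J.ptype a = {p₁, p₂} ∧
    ((J.Undersub M s p₁ ∧ J.Undersub M s p₂) ∨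
     (J.Undersub M s p₁ ∧ ∃ b ∈ J.Mp M s p₂, J.PrefersS s a b) ∨
     (J.Undersub M s p₂ ∧ ∃ b ∈ J.Mp M s p₁, J.PrefersS s a b) ∨
     (∃ b ∈ J.Mpr M s p₁ p₂, J.PrefersS s a b) ∨
     (∃ b₁ ∈ J.Mp M s p₁, ∃ b₂ ∈ J.Mp M s p₂, b₁ ≠ b₂ ∧ J.PrefersS s a b₁ ∧ J.PrefersS s a b₂))

def Stable (M : Finset (A × S)) : Prop :=
  J.IsMatching M ∧ ∀ a s, ¬ J.Blocks M a s

end TAP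
open TAP in
/-- The instance J₂: applicants a₁ = 0, a₂ = 1, a₃ = 2; schools s₁ = 0, s₂ = 1;
subjects F = 0, I = 1, M = 2. -/
def J₂ : TAP (Fin 3) (Fin 2) (Fin 3) where
  ptype := ![{0, 2}, {1, 2}, {0, 1}]
  prefA := ![[1, 0], [0, 1], [0]]
  cap := ![![1, 1, 2], ![1, 1, 1]]
  prefS := ![[0, 2, 1], [1, 0]]

namespace TAP

variable {A S P : Type*} [DecidableEq A] [DecidableEq S] [DecidableEq P] (J : TAP A S P)

instance decidableIsMatching [Fintype A] [Fintype S] [Fintype P] (M : Finset (A × S)) :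
    Decidable (J.IsMatching M) := by
  unfold IsMatching IsAssignment; infer_instance

instance decidableUndersub (M : Finset (A × S)) (s : S) (p : P) :
    Decidable (J.Undersub M s p) := by
  unfold Undersub; infer_instance

instance decidablePrefersA (a : A) (s s' : S) : Decidable (J.PrefersA a s s') := by
  unfold PrefersA; infer_instance

instance decidablePrefersS (s : S) (a a' : A) : Decidable (J.PrefersS s a a') := by
  unfold PrefersS; infer_instance

instance decidableUnassigned [Fintype S] (M : Finset (A × S)) (a : A) :
    Decidable (Unassigned M a) := by
  unfold Unassigned; infer_instance

instance decidableBlocks [Fintype S] [Fintype P] (M : Finset (A × S)) (a : A) (s : S) :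
    Decidable (J.Blocks M a s) := by
  unfold Blocks; infer_instance

instance decidableStable [Fintype A] [Fintype S] [Fintype P] (M : Finset (A × S)) :
    Decidable (J.Stable M) := by
  unfold Stable; infer_instance

end TAP

theorem stmt0 : ¬ ∃ M : Finset (Fin 3 × Fin 2), J₂.Stable M := by
  decide +kernel
end

section
/- Let J be a TAP instance in which every school's preference order is the restriction of a common master list a₁, a₂, …, a_n of the applicants. Then the matching M produced by the Serial Dictatorship algorithm — starting from M = ∅ and processing the applicants in master-list order, assigning each applicant a_i to the first school s on her preference list such that currently |M_p(s)| < c_p(s) for both subjects p ∈ p(a_i), and leaving a_i unassigned if no such school exists — is a stable matching of J. -/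
namespace TAP

variable {A S P : Type*} [DecidableEq A] [DecidableEq S] [DecidableEq P] (J : TAP A S P)

/-- School `s` has enough free capacity in matching `M` to accept applicant `a`. -/
def Enough (M : Finset (A × S)) (a : A) (s : S) : Prop :=
  ∀ p ∈ J.ptype a, (J.Mp M s p).card < J.cap s p

instance (M : Finset (A × S)) (a : A) (s : S) : Decidable (J.Enough M a s) := by
  unfold Enough; infer_instance

/-- One step of serial dictatorship: applicant `a` is assigned to the first school on
her preference list with enough free capacity for her (if any). -/
def serialStep (M : Finset (A × S)) (a : A) : Finset (A × S) :=
  match (J.prefA a).find? (fun s => decide (J.Enough M a s)) with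
  | some s => insert (a, s) M
  | none => M

/-- Serial dictatorship: process the applicants in master-list order. -/
def serialDict (ml : List A) : Finset (A × S) := ml.foldl J.serialStep ∅

end TAP

namespace TAP

variable {A S P : Type*} [DecidableEq A] [DecidableEq S] [DecidableEq P] (J : TAP A S P)

lemma mem_Mp {M : Finset (A × S)} {s : S} {p : P} {a : A} :
    a ∈ J.Mp M s p ↔ (a, s) ∈ M ∧ p ∈ J.ptype a := by
  simp [Mp]

lemma mem_Mpr {M : Finset (A × S)} {s : S} {p r : P} {a : A} :
    a ∈ J.Mpr M s p r ↔ (a, s) ∈ M ∧ J.ptype a = {p, r} := by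
  simp [Mpr]

lemma Mp_mono {M N : Finset (A × S)} (h : M ⊆ N) (s : S) (p : P) :
    J.Mp M s p ⊆ J.Mp N s p := by
  intro a ha
  rw [mem_Mp] at ha ⊢
  exact ⟨h ha.1, ha.2⟩

lemma mem_serialStep {M : Finset (A × S)} {a : A} {x : A × S} :
    x ∈ J.serialStep M a ↔
      x ∈ M ∨ x.1 = a ∧ (J.prefA a).find? (fun s => decide (J.Enough M a s)) = some x.2 := by
  obtain ⟨b, s⟩ := x
  unfold serialStep
  cases h : (J.prefA a).find? (fun s => decide (J.Enough M a s)) with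
  | none => simp
  | some t =>
    simp only [Finset.mem_insert, Prod.mk.injEq, Option.some.injEq]
    rw [or_comm, eq_comm (a := t)]

lemma subset_foldl_serialStep (l : List A) (M : Finset (A × S)) :
    M ⊆ l.foldl J.serialStep M := by
  induction l generalizing M with
  | nil => simp
  | cons a l ih =>
    exact fun x hx => ih (J.serialStep M a) (J.mem_serialStep.2 (Or.inl hx))

lemma mem_or_fst_mem_of_mem_foldl (l : List A) (M : Finset (A × S)) {x : A × S}
    (hx : x ∈ l.foldl J.serialStep M) : x ∈ M ∨ x.1 ∈ l := by
  induction l generalizing M with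
  | nil => exact Or.inl hx
  | cons a l ih =>
    rcases ih _ hx with h | h
    · rcases J.mem_serialStep.1 h with h | h
      · exact Or.inl h
      · simp [h.1]
    · simp [h]

lemma fst_mem_of_mem_serialDict {l : List A} {x : A × S} (hx : x ∈ J.serialDict l) :
    x.1 ∈ l := by
  simpa using J.mem_or_fst_mem_of_mem_foldl l ∅ hx

lemma serialDict_append (l l' : List A) :
    J.serialDict (l ++ l') = l'.foldl J.serialStep (J.serialDict l) := by
  simp [serialDict]

lemma IsMatching.serialStep {M : Finset (A × S)} (hM : J.IsMatching M) {a : A}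
    (ha : Unassigned M a) : J.IsMatching (J.serialStep M a) := by
  obtain ⟨⟨hacc, huniq⟩, hcap⟩ := hM
  refine ⟨⟨fun x hx => ?_, fun b s s' hs hs' => ?_⟩, fun s p => ?_⟩
  · rcases J.mem_serialStep.1 hx with h | ⟨h, hf⟩
    · exact hacc x h
    · rw [h]
      exact List.mem_of_find?_eq_some hf
  · rcases J.mem_serialStep.1 hs with h | ⟨h, hf⟩ <;>
      rcases J.mem_serialStep.1 hs' with h' | ⟨h', hf'⟩
    · exact huniq b s s' h h'
    · subst h'
      exact absurd h (ha s)
    · subst h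
      exact absurd h' (ha s')
    · exact Option.some.inj (hf.symm.trans hf')
  · by_cases hnew : J.Mp (J.serialStep M a) s p ⊆ J.Mp M s p
    · exact (Finset.card_le_card hnew).trans (hcap s p)
    · obtain ⟨b, hb, hbM⟩ := Finset.not_subset.1 hnew
      rw [mem_Mp] at hb hbM
      rcases J.mem_serialStep.1 hb.1 with h | ⟨rfl, hf⟩
      · exact absurd ⟨h, hb.2⟩ hbM
      · have hlt : (J.Mp M s p).card < J.cap s p := by
          have := List.find?_some hf
          exact (of_decide_eq_true this) p hb.2
        have hsub : J.Mp (J.serialStep M b) s p ⊆ insert b (J.Mp M s p) := by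
          intro c hc
          rw [mem_Mp] at hc
          rcases J.mem_serialStep.1 hc.1 with h | ⟨h, -⟩
          · exact Finset.mem_insert_of_mem ((J.mem_Mp).2 ⟨h, hc.2⟩)
          · exact Finset.mem_insert.2 (Or.inl h)
        exact ((Finset.card_le_card hsub).trans (Finset.card_insert_le _ _)).trans hlt

lemma isMatching_serialDict {l : List A} (hl : l.Nodup) : J.IsMatching (J.serialDict l) := by
  induction l using List.reverseRecOn with
  | nil => simp [serialDict, IsMatching, IsAssignment, Mp]
  | append_singleton l a ih =>
    rw [serialDict_append]
    have hnd := List.nodup_append.1 hl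
    refine IsMatching.serialStep J (ih hnd.1) fun s hs => ?_
    exact hnd.2.2 a (J.fst_mem_of_mem_serialDict hs) a (by simp) rfl

/-- A school that `a` would rather have been assigned lacked capacity when `a` was processed. -/
lemma not_enough_of_prefers {l l' : List A} {a : A} (hnd : (l ++ a :: l').Nodup) {s : S}
    (hs : s ∈ J.prefA a)
    (hpref : Unassigned (J.serialDict (l ++ a :: l')) a ∨
      ∃ s', (a, s') ∈ J.serialDict (l ++ a :: l') ∧ J.PrefersA a s s') :
    ¬ J.Enough (J.serialDict l) a s := by
  cases hf : (J.prefA a).find? (fun s => decide (J.Enough (J.serialDict l) a s)) with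
  | none => simpa using List.find?_eq_none.1 hf s hs
  | some t =>
    have ht : (a, t) ∈ J.serialDict (l ++ a :: l') := by
      rw [serialDict_append, List.foldl_cons]
      exact J.subset_foldl_serialStep _ _ (J.mem_serialStep.2 (Or.inr ⟨rfl, hf⟩))
    rcases hpref with h | ⟨s', hs', -, -, hlt⟩
    · exact absurd ht (h t)
    · obtain rfl := (J.isMatching_serialDict hnd).1.2 a t s' ht hs'
      obtain ⟨-, u, v, huv, hu⟩ := List.find?_eq_some_iff_append.1 hf
      have hidx : (J.prefA a).idxOf t ≤ u.length := by
        rw [huv, List.idxOf_append]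
        split
        · exact List.idxOf_le_length
        · simp
      have hsu : s ∈ u := by
        by_contra hsu
        have : u.length ≤ (J.prefA a).idxOf s := by
          rw [huv, List.idxOf_append_of_notMem hsu]
          omega
        omega
      simpa using hu s hsu

lemma not_prefersS_of_mem_prefix {l l' : List A} {a b : A} {s : S}
    (hnd : (l ++ a :: l').Nodup)
    (hs : J.prefS s = (l ++ a :: l').filter (fun a => decide (s ∈ J.prefA a)))
    (hb : b ∈ l) : ¬ J.PrefersS s a b := by
  rintro ⟨-, hbs, hlt⟩
  have ha : a ∉ l := fun h => (List.nodup_append.1 hnd).2.2 a h a (by simp) rfl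
  rw [hs] at hbs hlt
  have hbf : b ∈ l.filter (fun a => decide (s ∈ J.prefA a)) :=
    List.mem_filter.2 ⟨hb, (List.mem_filter.1 hbs).2⟩
  have haf : a ∉ l.filter (fun a => decide (s ∈ J.prefA a)) :=
    fun h => ha (List.mem_filter.1 h).1
  rw [List.filter_append, List.idxOf_append_of_notMem haf, List.idxOf_append_of_mem hbf] at hlt
  have := List.idxOf_lt_length_of_mem hbf
  omega

end TAP

theorem stmt2 {A S P : Type*} [DecidableEq A] [DecidableEq S] [DecidableEq P]
    (J : TAP A S P) (hwf : J.WellFormed) (ml : List A) (hnd : ml.Nodup)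
    (hall : ∀ a : A, a ∈ ml)
    (hmaster : ∀ s : S, J.prefS s = ml.filter (fun a => decide (s ∈ J.prefA a))) :
    J.Stable (J.serialDict ml) := by
  refine ⟨J.isMatching_serialDict hnd, ?_⟩
  rintro a s ⟨hs, hpref, p₁, p₂, -, htype, hblock⟩
  obtain ⟨l, l', rfl⟩ := List.append_of_mem (hall a)
  have hfull := J.not_enough_of_prefers hnd hs hpref
  simp only [TAP.Enough, htype, not_forall, not_lt] at hfull
  obtain ⟨p, hp, hcap⟩ := hfull
  have hsub : J.Mp (J.serialDict l) s p ⊆ J.Mp (J.serialDict (l ++ a :: l')) s p := by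
    rw [TAP.serialDict_append]
    exact J.Mp_mono (J.subset_foldl_serialStep _ _) s p
  have hU : ¬ J.Undersub (J.serialDict (l ++ a :: l')) s p :=
    not_lt.2 (hcap.trans (Finset.card_le_card hsub))
  have heq := Finset.eq_of_subset_of_card_le hsub
    (((J.isMatching_serialDict hnd).2 s p).trans hcap)
  have hno : ∀ b ∈ J.Mp (J.serialDict (l ++ a :: l')) s p, ¬ J.PrefersS s a b := by
    intro b hb
    rw [← heq, TAP.mem_Mp] at hb
    exact J.not_prefersS_of_mem_prefix hnd (hmaster s) (J.fst_mem_of_mem_serialDict hb.1)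
  have hnor : ∀ b ∈ J.Mpr (J.serialDict (l ++ a :: l')) s p₁ p₂, ¬ J.PrefersS s a b := by
    intro b hb
    rw [TAP.mem_Mpr] at hb
    exact hno b ((J.mem_Mp).2 ⟨hb.1, hb.2 ▸ hp⟩)
  rcases hblock with h | ⟨h, b, hb, hab⟩ | ⟨h, b, hb, hab⟩ | ⟨b, hb, hab⟩ |
    ⟨b₁, hb₁, b₂, hb₂, -, hab₁, hab₂⟩
  case inr.inr.inr.inl => exact hnor b hb hab
  all_goals
    rcases Finset.mem_insert.1 hp with rfl | hp
    on_goal 2 => obtain rfl := Finset.mem_singleton.1 hp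
    all_goals grind
end
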